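/- Let κ, μ, r̂ > 0, m_t > 1 and r > 0. Set K = μ(1+κ) and, for m_d > 0, let D₁(r; m_d) = (2(m_t−1)^{m_t} m_d^{m_d} K^μ r^{2μ−1} r̂^{2m_t} / ((m_d+μκ)^{m_d} B(m_t,μ)(K r² + (m_t−1)r̂²)^{m_t+μ})) ₂F₁(m_d, m_t+μ; μ; K μ κ r² / ((m_d+μκ)(K r² + (m_t−1)r̂²))) denote the double shadowed κ-μ Type I (example 1) PDF. Then lim_{m_d → ∞} D₁(r; m_d) = (2(1+κ)^μ μ^μ e^{−κμ} ((m_t−1)r̂²)^{m_t} r^{2μ−1} / (B(m_t,μ)(r̂²(m_t−1) + r²(1+κ)μ)^{m_t+μ})) ₁F₁(m_t+μ; μ; μ²κ(1+κ)r² / (r̂²(m_t−1) + r²(1+κ)μ)), i.e., the double shadowed κ-μ Type I (example 1) PDF converges pointwise to the single shadowed κ-μ Type III (inverse Nakagami-m multiplicative shadowing) PDF as the dominant-component shadowing parameter tends to infinity. -/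

import Mathlib

open MeasureTheory Set

/-- Pochhammer (rising factorial) symbol `(a)_n = Γ(a+n)/Γ(a)`. -/
noncomputable def poch (a : ℝ) (n : ℕ) : ℝ := Real.Gamma (a + n) / Real.Gamma a

/-- Beta function `B(x,y) = Γ(x)Γ(y)/Γ(x+y)`. -/
noncomputable def betaFn (x y : ℝ) : ℝ := Real.Gamma x * Real.Gamma y / Real.Gamma (x + y)

/-- Modified Bessel function of the first kind of real order ν. -/
noncomputable def besselI (ν x : ℝ) : ℝ :=
  ∑' k : ℕ, (x / 2) ^ (ν + 2 * (k : ℝ)) / ((k.factorial : ℝ) * Real.Gamma (ν + (k : ℝ) + 1))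

/-- Modified Bessel function of the second kind of real order ν. -/
noncomputable def besselK (ν x : ℝ) : ℝ :=
  ∫ t in Ioi (0 : ℝ), Real.exp (-x * Real.cosh t) * Real.cosh (ν * t)

/-- Confluent hypergeometric function ₁F₁(a;b;z). -/
noncomputable def hyp1F1 (a b z : ℝ) : ℝ :=
  ∑' n : ℕ, poch a n * z ^ n / (poch b n * (n.factorial : ℝ))

/-- Gauss hypergeometric function ₂F₁(a,b;c;z). -/
noncomputable def hyp2F1 (a b c z : ℝ) : ℝ :=
  ∑' n : ℕ, poch a n * poch b n * z ^ n / (poch c n * (n.factorial : ℝ))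

/-- Tricomi confluent hypergeometric function U(a,b,z). -/
noncomputable def tricomiU (a b z : ℝ) : ℝ :=
  (1 / Real.Gamma a) *
    ∫ t in Ioi (0 : ℝ), Real.exp (-z * t) * t ^ (a - 1) * (1 + t) ^ (b - a - 1)

/-- Regularized generalized hypergeometric function ₃F̃₁(a₁,a₂,a₃;b;z). -/
noncomputable def hyp3F1reg (a₁ a₂ a₃ b z : ℝ) : ℝ :=
  ∑' n : ℕ, poch a₁ n * poch a₂ n * poch a₃ n * z ^ n /
    (Real.Gamma (b + n) * (n.factorial : ℝ))

/-- Regularized generalized hypergeometric function ₂F̃₂(a,b;c,d;z). -/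
noncomputable def hyp2F2reg (a b c d z : ℝ) : ℝ :=
  ∑' n : ℕ, poch a n * poch b n * z ^ n /
    (Real.Gamma (c + n) * Real.Gamma (d + n) * (n.factorial : ℝ))

open Filter Topology

lemma poch_zero {a : ℝ} (ha : 0 < a) : poch a 0 = 1 := by
  simp [poch, (Real.Gamma_pos_of_pos ha).ne']

lemma poch_succ {a : ℝ} (ha : 0 < a) (n : ℕ) : poch a (n + 1) = poch a n * (a + n) := by
  have h : a + n ≠ 0 := by positivity
  unfold poch
  push_cast
  rw [← add_assoc, Real.Gamma_add_one h]
  ring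

lemma poch_pos {a : ℝ} (ha : 0 < a) (n : ℕ) : 0 < poch a n :=
  div_pos (Real.Gamma_pos_of_pos (by positivity)) (Real.Gamma_pos_of_pos ha)

lemma tendsto_add_div_add_atTop (a b : ℝ) :
    Tendsto (fun t : ℝ => (t + a) / (t + b)) atTop (𝓝 1) := by
  have h : Tendsto (fun t : ℝ => 1 + (a - b) / (t + b)) atTop (𝓝 (1 + 0)) :=
    tendsto_const_nhds.add
      (tendsto_const_nhds.div_atTop (tendsto_atTop_add_const_right _ b tendsto_id))
  rw [add_zero] at h
  refine h.congr' ?_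
  filter_upwards [eventually_gt_atTop (-b)] with t ht
  have : t + b ≠ 0 := by linarith
  field_simp
  ring

lemma tendsto_poch_div_add_pow (c : ℝ) (n : ℕ) :
    Tendsto (fun t : ℝ => poch t n / (t + c) ^ n) atTop (𝓝 1) := by
  induction n with
  | zero =>
    refine tendsto_const_nhds.congr' ?_
    filter_upwards [eventually_gt_atTop 0] with t ht
    simp [poch_zero ht]
  | succ n ih =>
    have h := ih.mul (tendsto_add_div_add_atTop n c)
    rw [mul_one] at h
    refine h.congr' ?_
    filter_upwards [eventually_gt_atTop 0] with t ht
    rw [poch_succ ht, pow_succ, div_mul_div_comm]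

lemma poch_div_add_pow_le {c M t : ℝ} (hc : 0 ≤ c) (hM : 0 < M) (ht : M ≤ t) (n : ℕ) :
    poch t n / (t + c) ^ n ≤ poch M n / M ^ n := by
  have ht0 : 0 < t := hM.trans_le ht
  induction n with
  | zero => simp [poch_zero ht0, poch_zero hM]
  | succ n ih =>
    rw [poch_succ ht0, poch_succ hM, pow_succ, pow_succ, ← div_mul_div_comm, ← div_mul_div_comm]
    refine mul_le_mul ih ?_ (by positivity) (div_nonneg (poch_pos hM n).le (by positivity))
    rw [div_le_div_iff₀ (by positivity) hM]
    have h₁ : (n : ℝ) * M ≤ n * t := by gcongr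
    have h₂ : 0 ≤ (M + n) * c := by positivity
    linarith

lemma summable_hyp2F1 {a b c z : ℝ} (ha : 0 < a) (hb : 0 < b) (hc : 0 < c)
    (hz : 0 < z) (hz1 : z < 1) :
    Summable fun n : ℕ => poch a n * poch b n * z ^ n / (poch c n * (n.factorial : ℝ)) := by
  have hpos (n : ℕ) :
      0 < poch a n * poch b n * z ^ n / (poch c n * (n.factorial : ℝ)) := by
    have := poch_pos ha n
    have := poch_pos hb n
    have := poch_pos hc n
    positivity
  refine summable_of_ratio_test_tendsto_lt_one hz1 (Eventually.of_forall fun n => (hpos n).ne') ?_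
  have h := (((tendsto_add_div_add_atTop a c).mul (tendsto_add_div_add_atTop b 1)).mul_const
    z).comp (tendsto_natCast_atTop_atTop (R := ℝ))
  rw [mul_one, one_mul] at h
  refine h.congr fun n => ?_
  rw [Real.norm_of_nonneg (hpos _).le, Real.norm_of_nonneg (hpos _).le, poch_succ ha,
    poch_succ hb, poch_succ hc, Nat.factorial_succ]
  have := poch_pos ha n
  have := poch_pos hb n
  have := poch_pos hc n
  simp only [Function.comp_apply]
  push_cast
  field_simp
  ring

/-- The confluence limit taking `₂F₁` to `₁F₁`. -/
lemma tendsto_hyp2F1_hyp1F1 {a b c x : ℝ} (ha : 0 < a) (hb : 0 < b) (hc : 0 ≤ c) (hx : 0 < x) :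
    Tendsto (fun t : ℝ => hyp2F1 t a b (x / (t + c))) atTop (𝓝 (hyp1F1 a b x)) := by
  have hM : 0 < x + 1 := by positivity
  have hterm (t : ℝ) (n : ℕ) :
      poch t n * poch a n * (x / (t + c)) ^ n / (poch b n * (n.factorial : ℝ)) =
        poch t n / (t + c) ^ n * (poch a n * x ^ n / (poch b n * (n.factorial : ℝ))) := by
    rw [div_pow]
    ring
  have hcoef (n : ℕ) : 0 ≤ poch a n * x ^ n / (poch b n * (n.factorial : ℝ)) := by
    have := poch_pos ha n
    have := poch_pos hb n
    positivity
  refine tendsto_tsum_of_dominated_convergence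
    (summable_hyp2F1 (z := x / (x + 1)) hM ha hb (by positivity)
      ((div_lt_one hM).2 (lt_add_one x))) (fun n => ?_) ?_
  · simp_rw [hterm]
    simpa using (tendsto_poch_div_add_pow c n).mul_const
      (poch a n * x ^ n / (poch b n * (n.factorial : ℝ)))
  · filter_upwards [eventually_ge_atTop (x + 1)] with t ht n
    have ht0 : 0 < t := hM.trans_le ht
    have h0 : 0 ≤ poch t n / (t + c) ^ n := div_nonneg (poch_pos ht0 n).le (by positivity)
    rw [hterm, Real.norm_of_nonneg (mul_nonneg h0 (hcoef n))]
    calc _ ≤ poch (x + 1) n / (x + 1) ^ n *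
          (poch a n * x ^ n / (poch b n * (n.factorial : ℝ))) :=
          mul_le_mul_of_nonneg_right (poch_div_add_pow_le hc hM ht n) (hcoef n)
      _ = _ := by rw [div_pow]; ring

lemma tendsto_rpow_self_div_add_rpow_self {c : ℝ} (hc : 0 ≤ c) :
    Tendsto (fun t : ℝ => t ^ t / (t + c) ^ t) atTop (𝓝 (Real.exp (-c))) := by
  rw [Real.exp_neg]
  refine ((Real.tendsto_one_add_div_rpow_exp c).inv₀ (Real.exp_ne_zero c)).congr' ?_
  filter_upwards [eventually_gt_atTop 0] with t ht
  rw [← Real.div_rpow ht.le (by positivity), ← Real.inv_rpow (by positivity)]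
  congr 1
  field_simp

/-- Table III: the double shadowed κ-μ Type I (example 1) PDF converges
pointwise to the single shadowed κ-μ Type III (inverse Nakagami-m
multiplicative shadowing) PDF as the dominant shadowing parameter m_d → ∞. -/
theorem double_shadowed_typeI_example1_limit_md
    (κ μ mt rhat r K : ℝ)
    (hκ : 0 < κ) (hμ : 0 < μ) (hrhat : 0 < rhat) (hmt : 1 < mt) (hr : 0 < r)
    (hK : K = μ * (1 + κ)) :
    Filter.Tendsto
      (fun md : ℝ =>
        (2 * (mt - 1) ^ mt * md ^ md * K ^ μ * r ^ (2 * μ - 1) * rhat ^ (2 * mt) /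
            ((md + μ * κ) ^ md * betaFn mt μ *
              (K * r ^ 2 + (mt - 1) * rhat ^ 2) ^ (mt + μ))) *
          hyp2F1 md (mt + μ) μ
            (K * μ * κ * r ^ 2 / ((md + μ * κ) * (K * r ^ 2 + (mt - 1) * rhat ^ 2))))
      Filter.atTop
      (nhds ((2 * (1 + κ) ^ μ * μ ^ μ * Real.exp (-(κ * μ)) *
          ((mt - 1) * rhat ^ 2) ^ mt * r ^ (2 * μ - 1) /
          (betaFn mt μ * (rhat ^ 2 * (mt - 1) + r ^ 2 * (1 + κ) * μ) ^ (mt + μ))) *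
        hyp1F1 (mt + μ) μ
          (μ ^ 2 * κ * (1 + κ) * r ^ 2 /
            (rhat ^ 2 * (mt - 1) + r ^ 2 * (1 + κ) * μ)))) := by
  have hmt' : 0 < mt - 1 := sub_pos.2 hmt
  have hK0 : 0 < K := hK ▸ by positivity
  set S := K * r ^ 2 + (mt - 1) * rhat ^ 2 with hS
  have hS0 : 0 < S := by positivity
  have hS' : rhat ^ 2 * (mt - 1) + r ^ 2 * (1 + κ) * μ = S := by
    rw [hS, hK]
    ring
  have hKμ : K ^ μ = (1 + κ) ^ μ * μ ^ μ := by
    rw [hK, mul_comm, Real.mul_rpow (by positivity) hμ.le]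
  have hrt : ((mt - 1) * rhat ^ 2) ^ mt = (mt - 1) ^ mt * rhat ^ (2 * mt) := by
    rw [Real.mul_rpow hmt'.le (by positivity), Real.rpow_mul hrhat.le, Real.rpow_two]
  have hx : μ ^ 2 * κ * (1 + κ) * r ^ 2 / S = K * μ * κ * r ^ 2 / S := by
    rw [hK]
    ring
  rw [hS', hx, hrt]
  have hpre := (tendsto_rpow_self_div_add_rpow_self (c := μ * κ) (by positivity)).const_mul
    (2 * (mt - 1) ^ mt * K ^ μ * r ^ (2 * μ - 1) * rhat ^ (2 * mt) /
      (betaFn mt μ * S ^ (mt + μ)))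
  have hhyp := tendsto_hyp2F1_hyp1F1 (a := mt + μ) (b := μ) (c := μ * κ)
    (x := K * μ * κ * r ^ 2 / S) (by linarith) hμ (by positivity) (by positivity)
  convert hpre.mul hhyp using 2 with md
  · congr 1
    · rw [div_mul_div_comm]
      congr 1 <;> ring
    · rw [div_div, mul_comm S]
  · rw [hKμ, mul_comm κ μ]
    ring
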